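/- For any transformation semigroup (X,S), the following diagram of surjective order-preserving maps commutes: the map S^1 → I(X), a ↦ im(a), factors as the quotient S^1 → S^1/L followed by the induced map S^1/L → I(X); and the composite S^1/L → I(X) → I(X)/≡_S (induced map followed by the subduction-class quotient) equals the composite S^1/L → S^1/J → I(X)/≡_S (the quotient of L-classes to J-classes followed by the induced map on J-classes). Concretely: for all a ∈ S^1, the subduction class of im(a) equals the image of the J-class of a under the induced map, and all maps involved are surjective and order-preserving. -/

import Mathlib

/-- A transformation semigroup on the state set `X`: a set of self-maps of `X`
closed under composition. With the right-action convention `x^(st) = (x^s)^t`,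
the semigroup product `s * t` corresponds to the function `t ∘ s`. -/
structure TransSgp (X : Type*) where
  carrier : Set (X → X)
  comp_mem : ∀ {s t : X → X}, s ∈ carrier → t ∈ carrier → (t ∘ s) ∈ carrier

namespace TransSgp

variable {X : Type*} (T : TransSgp X)

/-- `S¹`: the semigroup together with the identity map adjoined. -/
def S1 : Set (X → X) := insert id T.carrier

/-- The image set `I(X) = { im(s) : s ∈ S¹ }`. -/
def ImageSet : Set (Set X) := {P | ∃ s ∈ T.S1, P = Set.range s}

/-- The subduction relation: `P ⊆_S Q` iff `P ⊆ Q^s` for some `s ∈ S¹`. -/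
def Subd (P Q : Set X) : Prop := ∃ s ∈ T.S1, P ⊆ s '' Q

/-- Subduction equivalence: mutual subduction. -/
def SubdEquiv (P Q : Set X) : Prop := T.Subd P Q ∧ T.Subd Q P

/-- Green's `≤_L` preorder: `a ≤_L b` iff `a ∈ S¹ b`, i.e. `a = u·b = b ∘ u`. -/
def Lle (a b : X → X) : Prop := ∃ u ∈ T.S1, a = b ∘ u

/-- Green's `≤_J` preorder: `a ≤_J b` iff `a ∈ S¹ b S¹`, i.e. `a = u·b·v = v ∘ b ∘ u`. -/
def Jle (a b : X → X) : Prop := ∃ u ∈ T.S1, ∃ v ∈ T.S1, a = v ∘ b ∘ u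

/-- Green's `L`-equivalence. -/
def LEquiv (a b : X → X) : Prop := T.Lle a b ∧ T.Lle b a

/-- Green's `J`-equivalence. -/
def JEquiv (a b : X → X) : Prop := T.Jle a b ∧ T.Jle b a

end TransSgp

namespace TransSgp

variable {X : Type*} (T : TransSgp X)

theorem id_mem_S1 : id ∈ T.S1 := Set.mem_insert _ _

variable {T}

theorem comp_mem_S1 {s t : X → X} (hs : s ∈ T.S1) (ht : t ∈ T.S1) : t ∘ s ∈ T.S1 := by
  rcases hs with rfl | hs
  · exact ht
  · rcases ht with rfl | ht
    · exact Or.inr hs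
    · exact Or.inr (T.comp_mem hs ht)

theorem Lle.refl (a : X → X) : T.Lle a a := ⟨id, T.id_mem_S1, rfl⟩

theorem Lle.trans {a b c : X → X} : T.Lle a b → T.Lle b c → T.Lle a c := by
  rintro ⟨u, hu, rfl⟩ ⟨v, hv, rfl⟩
  exact ⟨v ∘ u, comp_mem_S1 hu hv, rfl⟩

theorem Jle.refl (a : X → X) : T.Jle a a := ⟨id, T.id_mem_S1, id, T.id_mem_S1, rfl⟩

theorem Jle.trans {a b c : X → X} : T.Jle a b → T.Jle b c → T.Jle a c := by
  rintro ⟨u, hu, v, hv, rfl⟩ ⟨u', hu', v', hv', rfl⟩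
  exact ⟨u' ∘ u, comp_mem_S1 hu hu', v ∘ v', comp_mem_S1 hv' hv, rfl⟩

theorem Lle.jle {a b : X → X} : T.Lle a b → T.Jle a b := by
  rintro ⟨u, hu, rfl⟩
  exact ⟨u, hu, id, T.id_mem_S1, rfl⟩

theorem Lle.range_subset {a b : X → X} : T.Lle a b → Set.range a ⊆ Set.range b := by
  rintro ⟨u, -, rfl⟩
  exact Set.range_comp_subset_range u b

theorem Subd.of_subset {P Q : Set X} (h : P ⊆ Q) : T.Subd P Q :=
  ⟨id, T.id_mem_S1, by rwa [Set.image_id]⟩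

theorem Subd.trans {P Q R : Set X} : T.Subd P Q → T.Subd Q R → T.Subd P R := by
  rintro ⟨s, hs, hP⟩ ⟨t, ht, hQ⟩
  refine ⟨s ∘ t, comp_mem_S1 ht hs, hP.trans ?_⟩
  rw [Set.image_comp]
  exact Set.image_mono hQ

theorem Jle.subd_range {a b : X → X} : T.Jle a b → T.Subd (Set.range a) (Set.range b) := by
  rintro ⟨u, -, v, hv, rfl⟩
  refine ⟨v, hv, ?_⟩
  rw [Set.range_comp]
  exact Set.image_mono (Set.range_comp_subset_range u b)

variable (T)

theorem equivalence_LEquiv : Equivalence fun a b : T.S1 => T.LEquiv a.1 b.1 :=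
  ⟨fun _ => ⟨.refl _, .refl _⟩, fun h => ⟨h.2, h.1⟩,
    fun h k => ⟨h.1.trans k.1, k.2.trans h.2⟩⟩

theorem equivalence_JEquiv : Equivalence fun a b : T.S1 => T.JEquiv a.1 b.1 :=
  ⟨fun _ => ⟨.refl _, .refl _⟩, fun h => ⟨h.2, h.1⟩,
    fun h k => ⟨h.1.trans k.1, k.2.trans h.2⟩⟩

theorem equivalence_SubdEquiv :
    Equivalence fun P Q : T.ImageSet => T.SubdEquiv P.1 Q.1 :=
  ⟨fun _ => ⟨.of_subset subset_rfl, .of_subset subset_rfl⟩, fun h => ⟨h.2, h.1⟩,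
    fun h k => ⟨h.1.trans k.1, k.2.trans h.2⟩⟩

end TransSgp

/-- For any transformation semigroup `(X,S)` with `X` finite, the
diagram of surjective order-preserving maps commutes: `a ↦ im(a)` from `S¹` to `I(X)`
factors through the quotient `S¹ → S¹/L` via an induced map `im̄ : S¹/L → I(X)`, and
the composite `S¹/L → I(X) → I(X)/≡_S` equals the composite
`S¹/L → S¹/J → I(X)/≡_S`; all maps involved are surjective and order-preserving. -/
theorem commutative_diagram {X : Type*} [Finite X] (T : TransSgp X) :
    ∃ (eL : Equivalence fun a b : T.S1 => T.LEquiv a.1 b.1)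
      (eJ : Equivalence fun a b : T.S1 => T.JEquiv a.1 b.1)
      (eS : Equivalence fun P Q : T.ImageSet => T.SubdEquiv P.1 Q.1),
      let sL : Setoid T.S1 := ⟨fun a b => T.LEquiv a.1 b.1, eL⟩
      let sJ : Setoid T.S1 := ⟨fun a b => T.JEquiv a.1 b.1, eJ⟩
      let sS : Setoid T.ImageSet := ⟨fun P Q => T.SubdEquiv P.1 Q.1, eS⟩
      let rL : Quotient sL → Quotient sL → Prop := fun x y =>
        ∃ a b : T.S1, x = Quotient.mk sL a ∧ y = Quotient.mk sL b ∧ T.Lle a.1 b.1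
      let rJ : Quotient sJ → Quotient sJ → Prop := fun x y =>
        ∃ a b : T.S1, x = Quotient.mk sJ a ∧ y = Quotient.mk sJ b ∧ T.Jle a.1 b.1
      let rS : Quotient sS → Quotient sS → Prop := fun x y =>
        ∃ P Q : T.ImageSet, x = Quotient.mk sS P ∧ y = Quotient.mk sS Q ∧ T.Subd P.1 Q.1
      ∃ (imbar : Quotient sL → T.ImageSet)       -- induced map S¹/L → I(X)
        (θ : Quotient sL → Quotient sJ)          -- canonical surjection S¹/L → S¹/J
        (Fbar : Quotient sJ → Quotient sS),      -- induced map S¹/J → I(X)/≡_S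
        -- characterizations on representatives (hence the whole diagram commutes,
        -- in particular `im` factors as `imbar ∘ (quotient map)`):
        (∀ a : T.S1, imbar (Quotient.mk sL a) = ⟨Set.range a.1, a.1, a.2, rfl⟩) ∧
        (∀ a : T.S1, θ (Quotient.mk sL a) = Quotient.mk sJ a) ∧
        (∀ a : T.S1, Fbar (Quotient.mk sJ a) = Quotient.mk sS ⟨Set.range a.1, a.1, a.2, rfl⟩) ∧
        -- commutativity of the lower square:
        (∀ x : Quotient sL, Quotient.mk sS (imbar x) = Fbar (θ x)) ∧
        -- surjectivity of all the maps:
        Function.Surjective imbar ∧ Function.Surjective θ ∧ Function.Surjective Fbar ∧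
        (∀ P : T.ImageSet, ∃ a : T.S1, Set.range a.1 = P.1) ∧
        -- order-preservation of all the maps:
        (∀ a b : T.S1, T.Lle a.1 b.1 → Set.range a.1 ⊆ Set.range b.1) ∧
        (∀ x y : Quotient sL, rL x y → (imbar x).1 ⊆ (imbar y).1) ∧
        (∀ x y : Quotient sL, rL x y → rJ (θ x) (θ y)) ∧
        (∀ x y : Quotient sJ, rJ x y → rS (Fbar x) (Fbar y)) ∧
        (∀ P Q : T.ImageSet, P.1 ⊆ Q.1 →
          rS (Quotient.mk sS P) (Quotient.mk sS Q)) := by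
  refine ⟨T.equivalence_LEquiv, T.equivalence_JEquiv, T.equivalence_SubdEquiv, ?_⟩
  intro sL sJ sS rL rJ rS
  let im : T.S1 → T.ImageSet := fun a => ⟨Set.range a.1, a.1, a.2, rfl⟩
  have im_surjective : Function.Surjective im := by
    rintro ⟨_, s, hs, rfl⟩
    exact ⟨⟨s, hs⟩, rfl⟩
  refine ⟨Quotient.lift im fun a b h => Subtype.ext
      (h.1.range_subset.antisymm h.2.range_subset),
    Quotient.lift (Quotient.mk sJ) fun a b h => Quotient.sound ⟨h.1.jle, h.2.jle⟩,
    Quotient.lift (fun a => Quotient.mk sS (im a)) fun a b h =>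
      Quotient.sound ⟨h.1.subd_range, h.2.subd_range⟩,
    fun _ => rfl, fun _ => rfl, fun _ => rfl, ?_, ?_, ?_, ?_, ?_, ?_, ?_, ?_, ?_, ?_⟩
  · rintro ⟨a⟩
    rfl
  · intro P
    obtain ⟨a, rfl⟩ := im_surjective P
    exact ⟨Quotient.mk sL a, rfl⟩
  · rintro ⟨a⟩
    exact ⟨Quotient.mk sL a, rfl⟩
  · rintro ⟨P⟩
    obtain ⟨a, rfl⟩ := im_surjective P
    exact ⟨Quotient.mk sJ a, rfl⟩
  · intro P
    obtain ⟨a, rfl⟩ := im_surjective P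
    exact ⟨a, rfl⟩
  · exact fun a b h => h.range_subset
  · rintro _ _ ⟨a, b, rfl, rfl, h⟩
    exact h.range_subset
  · rintro _ _ ⟨a, b, rfl, rfl, h⟩
    exact ⟨a, b, rfl, rfl, h.jle⟩
  · rintro _ _ ⟨a, b, rfl, rfl, h⟩
    exact ⟨im a, im b, rfl, rfl, h.subd_range⟩
  · exact fun P Q h => ⟨P, Q, rfl, rfl, .of_subset h⟩
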